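/- Let 1 < p < n, set a = (n−p)/(γ−p), and let p < q be real. Let w : Ω_γ → [0,∞) be Borel measurable with ∫_{Ω_γ} (w(x)/w_γ(x)^{p/q})^{q/(q−p)} dx < ∞. Then for every Borel measurable v : Ω_n → [0,∞) with ∫_{Ω_n} v(y)^q dy < ∞, the inequality ∫_{Ω_γ} v(ψ_a(x))^p · w(x) dx ≤ (∫_{Ω_n} v(y)^q dy)^{p/q} · (∫_{Ω_γ} (w(x)/w_γ(x)^{p/q})^{q/(q−p)} dx)^{(q−p)/q} holds. -/

import Mathlib

open MeasureTheory Real Filter Topology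
open scoped ENNReal

noncomputable section

/-- The last coordinate `x_n` of a point in `ℝ^n` (junk value `0` if `n = 0`). -/
def lastCoord {n : ℕ} (x : EuclideanSpace ℝ (Fin n)) : ℝ :=
  if h : 0 < n then x ⟨n - 1, Nat.sub_lt h Nat.one_pos⟩ else 0

/-- The outward cuspidal domain
`Ω_γ = {x : 0 < x_n < 1, 0 < x_i < x_n ^ σ for i = 1, …, n-1}` (with `σ = (γ-1)/(n-1)`). -/
def cuspDomain (n : ℕ) (σ : ℝ) : Set (EuclideanSpace ℝ (Fin n)) :=
  {x | 0 < lastCoord x ∧ lastCoord x < 1 ∧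
    ∀ i : Fin n, (i : ℕ) + 1 ≠ n → 0 < x i ∧ x i < lastCoord x ^ σ}

/-- The model simplex `Ω_n = {y : 0 < y_n < 1, 0 < y_i < y_n for i = 1, …, n-1}`. -/
def simplexDomain (n : ℕ) : Set (EuclideanSpace ℝ (Fin n)) := cuspDomain n 1

/-- The map `φ_a(y) = (y_1 y_n^{aσ-1}, …, y_{n-1} y_n^{aσ-1}, y_n^a)`. -/
def phiMap (n : ℕ) (σ a : ℝ) (y : EuclideanSpace ℝ (Fin n)) : EuclideanSpace ℝ (Fin n) :=
  WithLp.toLp 2 fun i : Fin n => if (i : ℕ) + 1 = n then lastCoord y ^ a else y i * lastCoord y ^ (a * σ - 1)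

/-- The map `ψ_a(x) = (x_1 x_n^{1/a-σ}, …, x_{n-1} x_n^{1/a-σ}, x_n^{1/a})`. -/
def psiMap (n : ℕ) (σ a : ℝ) (x : EuclideanSpace ℝ (Fin n)) : EuclideanSpace ℝ (Fin n) :=
  WithLp.toLp 2 fun i : Fin n => if (i : ℕ) + 1 = n then lastCoord x ^ (1 / a) else x i * lastCoord x ^ (1 / a - σ)

/-- The weight `w_{γ,a}(x) = (1/a) x_n^{n/a - γ}`. -/
def weightA (n : ℕ) (γ a : ℝ) (x : EuclideanSpace ℝ (Fin n)) : ℝ :=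
  (1 / a) * lastCoord x ^ ((n : ℝ) / a - γ)

/-- The weight `w_γ(x) = ((γ-p)/(n-p)) x_n^{p(γ-n)/(n-p)}`. -/
def weightG (n : ℕ) (γ p : ℝ) (x : EuclideanSpace ℝ (Fin n)) : ℝ :=
  ((γ - p) / ((n : ℝ) - p)) * lastCoord x ^ (p * (γ - (n : ℝ)) / ((n : ℝ) - p))

/-- The last index. -/
def lastIdx (n : ℕ) (hn : 2 ≤ n) : Fin n := ⟨n - 1, by omega⟩

lemma lastCoord_eq {n : ℕ} (hn : 2 ≤ n) (x : EuclideanSpace ℝ (Fin n)) :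
    lastCoord x = x (lastIdx n hn) := by
  have h : 0 < n := by omega
  simp [lastCoord, h, lastIdx]

lemma idx_iff {n : ℕ} (hn : 2 ≤ n) (i : Fin n) : (i : ℕ) + 1 = n ↔ i = lastIdx n hn := by
  rw [Fin.ext_iff]
  simp only [lastIdx]
  omega

lemma measurable_lastCoord {n : ℕ} (hn : 2 ≤ n) :
    Measurable (lastCoord : EuclideanSpace ℝ (Fin n) → ℝ) := by
  have : (lastCoord : EuclideanSpace ℝ (Fin n) → ℝ) = fun x => x (lastIdx n hn) :=
    funext (lastCoord_eq hn)
  rw [this]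
  fun_prop

lemma measurableSet_cusp {n : ℕ} (hn : 2 ≤ n) (σ : ℝ) : MeasurableSet (cuspDomain n σ) := by
  have hl := measurable_lastCoord hn
  have e : cuspDomain n σ = {x | 0 < lastCoord x} ∩ ({x | lastCoord x < 1} ∩
      ⋂ i : Fin n, {x | (i : ℕ) + 1 ≠ n → 0 < x i ∧ x i < lastCoord x ^ σ}) := by
    ext x
    simp [cuspDomain]
  rw [e]
  refine (measurableSet_lt measurable_const hl).inter
    ((measurableSet_lt hl measurable_const).inter (MeasurableSet.iInter fun i => ?_))
  by_cases h : (i : ℕ) + 1 ≠ n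
  · simp only [h, ne_eq, not_false_eq_true, forall_true_left]
    have hi : Measurable (fun x : EuclideanSpace ℝ (Fin n) => x i) := by fun_prop
    exact (measurableSet_lt measurable_const hi).inter (measurableSet_lt hi (hl.pow_const σ))
  · simp [h]

lemma measurable_psi {n : ℕ} (hn : 2 ≤ n) (σ a : ℝ) : Measurable (psiMap n σ a) := by
  have hl := measurable_lastCoord hn
  unfold psiMap
  refine (WithLp.measurable_toLp 2 _).comp (measurable_pi_lambda _ fun i => ?_)
  by_cases h : (i : ℕ) + 1 = n
  · simp only [h, if_true]
    exact hl.pow_const _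
  · simp only [h, if_false]
    have hi : Measurable (fun x : EuclideanSpace ℝ (Fin n) => x i) := by fun_prop
    exact hi.mul (hl.pow_const _)

lemma psi_last {n : ℕ} (hn : 2 ≤ n) (σ a : ℝ) (x : EuclideanSpace ℝ (Fin n)) :
    lastCoord (psiMap n σ a x) = lastCoord x ^ (1 / a) := by
  rw [lastCoord_eq hn (psiMap n σ a x)]
  simp [psiMap, idx_iff hn]

lemma psi_ne {n : ℕ} (σ a : ℝ) (x : EuclideanSpace ℝ (Fin n)) (i : Fin n) (h : (i : ℕ) + 1 ≠ n) :
    psiMap n σ a x i = x i * lastCoord x ^ (1 / a - σ) := by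
  simp [psiMap, h]

lemma psi_mapsTo {n : ℕ} (hn : 2 ≤ n) (σ a : ℝ) (ha : 0 < a) :
    Set.MapsTo (psiMap n σ a) (cuspDomain n σ) (simplexDomain n) := by
  rintro x ⟨h0, h1, h2⟩
  have ha' : 0 < 1 / a := by positivity
  refine ⟨?_, ?_, fun i hi => ?_⟩
  · rw [psi_last hn]; positivity
  · rw [psi_last hn]; exact Real.rpow_lt_one h0.le h1 ha'
  · rw [psi_last hn, psi_ne _ _ _ _ hi, Real.rpow_one]
    obtain ⟨h3, h4⟩ := h2 i hi
    have hpos : 0 < lastCoord x ^ (1 / a - σ) := Real.rpow_pos_of_pos h0 _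
    refine ⟨mul_pos h3 hpos, ?_⟩
    calc _ < lastCoord x ^ σ * lastCoord x ^ (1 / a - σ) := by gcongr
      _ = _ := by rw [← Real.rpow_add h0]; congr 1; ring

lemma psi_injOn {n : ℕ} (hn : 2 ≤ n) (σ a : ℝ) (ha : 0 < a) :
    Set.InjOn (psiMap n σ a) (cuspDomain n σ) := by
  rintro x ⟨h0, h1, h2⟩ y ⟨k0, k1, k2⟩ hxy
  have ha' : 1 / a ≠ 0 := by positivity
  have hl : lastCoord x = lastCoord y := by
    have := congrArg lastCoord hxy
    rw [psi_last hn, psi_last hn] at this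
    exact (Real.rpow_left_inj h0.le k0.le ha').1 this
  ext i
  by_cases hi : (i : ℕ) + 1 = n
  · rw [idx_iff hn] at hi
    subst hi
    rw [← lastCoord_eq hn, ← lastCoord_eq hn, hl]
  · have := congrArg (fun z : EuclideanSpace ℝ (Fin n) => z i) hxy
    simp only [psi_ne _ _ _ _ hi] at this
    rw [hl] at this
    exact mul_right_cancel₀ (Real.rpow_pos_of_pos k0 _).ne' this

/-- Jacobian matrix of `psiMap`, with `b = 1/a`. -/
def psiMat (n : ℕ) (hn : 2 ≤ n) (σ b : ℝ) (x : EuclideanSpace ℝ (Fin n)) :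
    Matrix (Fin n) (Fin n) ℝ := fun i j =>
  if i = lastIdx n hn then (if j = lastIdx n hn then b * lastCoord x ^ (b - 1) else 0)
  else (if j = i then lastCoord x ^ (b - σ) else 0) +
    (if j = lastIdx n hn then x i * ((b - σ) * lastCoord x ^ (b - σ - 1)) else 0)

/-- Derivative of `psiMap`. -/
def psiDer (n : ℕ) (hn : 2 ≤ n) (σ b : ℝ) (x : EuclideanSpace ℝ (Fin n)) :
    EuclideanSpace ℝ (Fin n) →L[ℝ] EuclideanSpace ℝ (Fin n) :=
  LinearMap.toContinuousLinearMap (Matrix.toLpLin 2 2 (psiMat n hn σ b x))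

lemma psiDer_apply {n : ℕ} (hn : 2 ≤ n) (σ b : ℝ) (x h : EuclideanSpace ℝ (Fin n)) (i : Fin n) :
    psiDer n hn σ b x h i = if i = lastIdx n hn then b * lastCoord x ^ (b - 1) * h (lastIdx n hn)
      else lastCoord x ^ (b - σ) * h i +
        x i * ((b - σ) * lastCoord x ^ (b - σ - 1)) * h (lastIdx n hn) := by
  simp only [psiDer, LinearMap.coe_toContinuousLinearMap', Matrix.toLpLin_apply, Matrix.mulVec,
    dotProduct, psiMat]
  split_ifs with hi
  · simp
  · simp [add_mul, Finset.sum_add_distrib]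

lemma psiDer_det {n : ℕ} (hn : 2 ≤ n) (σ b : ℝ) (x : EuclideanSpace ℝ (Fin n)) :
    (psiDer n hn σ b x).det = b * lastCoord x ^ (b - 1) * (lastCoord x ^ (b - σ)) ^ (n - 1) := by
  have h1 : (psiDer n hn σ b x).det = (psiMat n hn σ b x).det := by
    simp only [psiDer, ContinuousLinearMap.det, LinearMap.coe_toContinuousLinearMap,
      Matrix.toLpLin_eq_toLin, LinearMap.det_toLin]
  rw [h1, Matrix.det_of_isUpperTriangular, ← Finset.mul_prod_erase _ _ (Finset.mem_univ (lastIdx n hn))]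
  · congr 1
    · simp [psiMat]
    · rw [Finset.prod_congr rfl (g := fun _ => lastCoord x ^ (b - σ))]
      · simp
      · intro i hi
        have := Finset.ne_of_mem_erase hi
        simp [psiMat, this]
  · intro i j hij
    have hij' : (j : ℕ) < i := hij
    have h2 : j ≠ lastIdx n hn := by
      rw [ne_eq, ← idx_iff hn]; have := i.2; omega
    have h3 : j ≠ i := by rintro rfl; omega
    simp [psiMat, h2, h3]

lemma psi_hasFDerivAt {n : ℕ} (hn : 2 ≤ n) (σ a : ℝ) (x : EuclideanSpace ℝ (Fin n))
    (hx : 0 < lastCoord x) (s : Set (EuclideanSpace ℝ (Fin n))) :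
    HasFDerivWithinAt (psiMap n σ a) (psiDer n hn σ (1 / a) x) s x := by
  rw [hasFDerivWithinAt_euclidean]
  intro i
  refine HasFDerivAt.hasFDerivWithinAt ?_
  have hp : ∀ j, HasFDerivAt (fun y : EuclideanSpace ℝ (Fin n) => y j)
      (PiLp.proj 2 (fun _ : Fin n => ℝ) j : EuclideanSpace ℝ (Fin n) →L[ℝ] ℝ) x := fun j =>
    (PiLp.proj 2 (fun _ : Fin n => ℝ) j : EuclideanSpace ℝ (Fin n) →L[ℝ] ℝ).hasFDerivAt
  have hx' : x (lastIdx n hn) ≠ 0 := by rw [← lastCoord_eq hn]; exact hx.ne'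
  by_cases hi : i = lastIdx n hn
  · have hi' := (idx_iff hn i).2 hi
    have e : (fun y => psiMap n σ a y i) = fun y => y (lastIdx n hn) ^ (1 / a) := by
      funext y
      simp [psiMap, hi', lastCoord_eq hn]
    rw [e]
    refine ((hp (lastIdx n hn)).rpow_const (Or.inl hx')).congr_fderiv ?_
    ext h
    simp [psiDer_apply, hi, lastCoord_eq hn]
  · have hi' : (i : ℕ) + 1 ≠ n := fun h => hi ((idx_iff hn i).1 h)
    have e : (fun y => psiMap n σ a y i) = fun y => y i * y (lastIdx n hn) ^ (1 / a - σ) := by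
      funext y
      simp [psiMap, hi', lastCoord_eq hn]
    rw [e]
    refine ((hp i).mul ((hp (lastIdx n hn)).rpow_const (Or.inl hx'))).congr_fderiv ?_
    ext h
    simp [psiDer_apply, hi, lastCoord_eq hn]
    ring

lemma jac_eq {n : ℕ} (hn : 2 ≤ n) (γ σ p a : ℝ) (hγ : (n : ℝ) < γ)
    (hσ : σ = (γ - 1) / ((n : ℝ) - 1)) (hpn : p < (n : ℝ))
    (haeq : a = ((n : ℝ) - p) / (γ - p)) (x : EuclideanSpace ℝ (Fin n)) (hx : 0 < lastCoord x) :
    (psiDer n hn σ (1 / a) x).det = weightG n γ p x := by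
  have hn' : (2 : ℝ) ≤ n := by exact_mod_cast hn
  have h1 : (n : ℝ) - 1 ≠ 0 := by linarith
  have h2 : (n : ℝ) - p ≠ 0 := by linarith
  have h3 : γ - p ≠ 0 := by linarith
  rw [psiDer_det, weightG, ← Real.rpow_natCast, ← Real.rpow_mul hx.le, mul_assoc,
    ← Real.rpow_add hx, Nat.cast_sub (by omega), Nat.cast_one, haeq, one_div_div]
  congr 2
  rw [hσ]
  field_simp
  ring

lemma weightG_pos {n : ℕ} (γ p : ℝ) (hγ : (n : ℝ) < γ) (hpn : p < (n : ℝ))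
    (x : EuclideanSpace ℝ (Fin n)) (hx : 0 < lastCoord x) : 0 < weightG n γ p x := by
  unfold weightG
  have h2 : 0 < (n : ℝ) - p := by linarith
  have h3 : 0 < γ - p := by linarith
  positivity

lemma change_var {n : ℕ} (hn : 2 ≤ n) (γ σ p a : ℝ) (hγ : (n : ℝ) < γ)
    (hσ : σ = (γ - 1) / ((n : ℝ) - 1)) (hpn : p < (n : ℝ))
    (haeq : a = ((n : ℝ) - p) / (γ - p)) (g : EuclideanSpace ℝ (Fin n) → ℝ≥0∞) :
    ∫⁻ x in cuspDomain n σ, ENNReal.ofReal (weightG n γ p x) * g (psiMap n σ a x) ≤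
      ∫⁻ y in simplexDomain n, g y := by
  have ha : 0 < a := by rw [haeq]; exact div_pos (by linarith) (by linarith)
  have key := lintegral_image_eq_lintegral_abs_det_fderiv_mul volume (measurableSet_cusp hn σ)
    (fun x hx => psi_hasFDerivAt hn σ a x hx.1 (cuspDomain n σ)) (psi_injOn hn σ a ha) g
  calc _ = ∫⁻ x in cuspDomain n σ, ENNReal.ofReal |(psiDer n hn σ (1 / a) x).det| *
        g (psiMap n σ a x) := by
        refine setLIntegral_congr_fun (measurableSet_cusp hn σ) fun x hx => ?_
        rw [jac_eq hn γ σ p a hγ hσ hpn haeq x hx.1, abs_of_pos (weightG_pos γ p hγ hpn x hx.1)]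
    _ = ∫⁻ y in psiMap n σ a '' cuspDomain n σ, g y := key.symm
    _ ≤ _ := lintegral_mono_set (psi_mapsTo hn σ a ha).image_subset

/-- Let `1 < p < n`, `a = (n-p)/(γ-p)` and `p < q`. For a Borel weight
`w : Ω_γ → [0,∞)` with `∫_{Ω_γ} (w/w_γ^{p/q})^{q/(q-p)} dx < ∞` and any Borel
`v : Ω_n → [0,∞)` with `∫_{Ω_n} v^q dy < ∞`, the Hölder-type inequality
`∫_{Ω_γ} v(ψ_a(x))^p w(x) dx ≤ (∫_{Ω_n} v^q dy)^{p/q} (∫_{Ω_γ} (w/w_γ^{p/q})^{q/(q-p)} dx)^{(q-p)/q}`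
holds. -/
theorem stmt_14 (n : ℕ) (hn : 2 ≤ n) (γ : ℝ) (hγ : (n : ℝ) < γ)
    (σ : ℝ) (hσ : σ = (γ - 1) / ((n : ℝ) - 1))
    (p q : ℝ) (hp : 1 < p) (hpn : p < (n : ℝ)) (hpq : p < q)
    (a : ℝ) (haeq : a = ((n : ℝ) - p) / (γ - p))
    (w : EuclideanSpace ℝ (Fin n) → ℝ) (hw0 : ∀ x, 0 ≤ w x) (hwm : Measurable w)
    (hwint : ∫⁻ x in cuspDomain n σ,
        ENNReal.ofReal ((w x / weightG n γ p x ^ (p / q)) ^ (q / (q - p))) ≠ ⊤)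
    (v : EuclideanSpace ℝ (Fin n) → ℝ) (hv0 : ∀ y, 0 ≤ v y) (hvm : Measurable v)
    (hvint : ∫⁻ y in simplexDomain n, ENNReal.ofReal (v y ^ q) ≠ ⊤) :
    ∫⁻ x in cuspDomain n σ, ENNReal.ofReal (v (psiMap n σ a x) ^ p * w x) ≤
      (∫⁻ y in simplexDomain n, ENNReal.ofReal (v y ^ q)) ^ (p / q) *
        (∫⁻ x in cuspDomain n σ,
          ENNReal.ofReal ((w x / weightG n γ p x ^ (p / q)) ^ (q / (q - p)))) ^ ((q - p) / q) := by
  have hq : 0 < q := by linarith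
  have hqp : 0 < q - p := by linarith
  have hp0 : 0 < p := by linarith
  have hWm : Measurable (weightG n γ p) :=
    ((measurable_lastCoord hn).pow_const _).const_mul _
  have hψ := measurable_psi hn σ a
  have hH := ENNReal.lintegral_mul_norm_pow_le (μ := volume.restrict (cuspDomain n σ))
    (f := fun x => ENNReal.ofReal (weightG n γ p x) * ENNReal.ofReal (v (psiMap n σ a x) ^ q))
    (g := fun x => ENNReal.ofReal ((w x / weightG n γ p x ^ (p / q)) ^ (q / (q - p))))
    (hWm.ennreal_ofReal.mul ((hvm.comp hψ).pow_const q).ennreal_ofReal).aemeasurable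
    ((hwm.div (hWm.pow_const _)).pow_const _).ennreal_ofReal.aemeasurable
    (p := p / q) (q := (q - p) / q) (by positivity) (by positivity) (by field_simp; ring)
  have hcv := change_var hn γ σ p a hγ hσ hpn haeq (fun y => ENNReal.ofReal (v y ^ q))
  calc _ = ∫⁻ x in cuspDomain n σ,
        (ENNReal.ofReal (weightG n γ p x) * ENNReal.ofReal (v (psiMap n σ a x) ^ q)) ^ (p / q) *
        (ENNReal.ofReal ((w x / weightG n γ p x ^ (p / q)) ^ (q / (q - p)))) ^ ((q - p) / q) := by
        refine setLIntegral_congr_fun (measurableSet_cusp hn σ) fun x hx => ?_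
        have hW := weightG_pos γ p hγ hpn x hx.1
        have hv := hv0 (psiMap n σ a x)
        have hw := hw0 x
        have hWp : 0 < weightG n γ p x ^ (p / q) := Real.rpow_pos_of_pos hW _
        rw [← ENNReal.ofReal_mul hW.le,
          ENNReal.ofReal_rpow_of_nonneg (by positivity) (by positivity),
          ENNReal.ofReal_rpow_of_nonneg (by positivity) (by positivity),
          ← ENNReal.ofReal_mul (by positivity)]
        congr 1
        rw [Real.mul_rpow hW.le (by positivity), ← Real.rpow_mul hv, ← Real.rpow_mul (by positivity),
          mul_div_cancel₀ p hq.ne', show q / (q - p) * ((q - p) / q) = 1 by field_simp,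
          Real.rpow_one]
        field_simp
    _ ≤ _ := hH
    _ ≤ _ := by gcongr
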